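/- arXiv:1107.3226 — 3 statements merged into one kernel-verified Lean document; each statement's English description precedes it below -/
import Mathlib

section
/- Deutsch–Jozsa, balanced case: if f : (Fin n → Bool) → Bool is balanced, i.e. the number of x with f x = false equals the number of x with f x = true, then the amplitude of the final state at the all-false string is zero: (W_n.mulVec ψ_f) (fun _ => false) = 0. -/
open Finset Matrix

/-- The Boolean dot product: the number of indices where both strings are `true`. -/
def bdot {n : ℕ} (x y : Fin n → Bool) : ℕ :=
  (Finset.univ.filter fun i => x i = true ∧ y i = true).card

/-- The Walsh–Hadamard matrix `W n`. -/
noncomputable def W (n : ℕ) : Matrix (Fin n → Bool) (Fin n → Bool) ℂ :=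
  Matrix.of fun x y => (-1 : ℂ) ^ bdot x y / (Real.sqrt (2 ^ n) : ℂ)

/-- `(−1)^b` for a Boolean `b`. -/
def bsign (b : Bool) : ℂ := if b then -1 else 1

/-- The state after the oracle in the Deutsch–Jozsa algorithm. -/
noncomputable def ψ {n : ℕ} (f : (Fin n → Bool) → Bool) : (Fin n → Bool) → ℂ :=
  fun x => bsign (f x) / (Real.sqrt (2 ^ n) : ℂ)

theorem bdot_const_false {n : ℕ} (y : Fin n → Bool) : bdot (fun _ => false) y = 0 := by
  simp [bdot]

/-- A sum of signs counts the `false` values minus the `true` values. -/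
theorem sum_bsign {α : Type*} [Fintype α] (f : α → Bool) :
    ∑ x, bsign (f x) = ((Finset.univ.filter fun x => f x = false).card : ℂ) -
      (Finset.univ.filter fun x => f x = true).card := by
  rw [Finset.card_filter, Finset.card_filter, Nat.cast_sum, Nat.cast_sum,
    ← Finset.sum_sub_distrib]
  refine Finset.sum_congr rfl fun x _ => ?_
  cases f x <;> simp [bsign]

/-- Deutsch–Jozsa, balanced case: the amplitude of the final state at the
all-false string vanishes. -/
theorem deutsch_jozsa_balanced {n : ℕ} (f : (Fin n → Bool) → Bool)
    (hf : (Finset.univ.filter fun x => f x = false).card =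
          (Finset.univ.filter fun x => f x = true).card) :
    (W n).mulVec (ψ f) (fun _ => false) = 0 := by
  have hsum : ∑ x, bsign (f x) = 0 := by rw [sum_bsign, hf, sub_self]
  simp only [Matrix.mulVec, dotProduct, W, ψ, Matrix.of_apply, bdot_const_false, pow_zero]
  rw [← Finset.mul_sum, ← Finset.sum_div, hsum, zero_div, mul_zero]
end

section
/- The states u_s are eigenvectors of the modular-multiplication operator: for every s : ℕ, U_x applied to u_s equals e^{2πis/r} · u_s, where r is the multiplicative order of x modulo N. -/
open Finset Complex

/-- The indicator function of `y : ZMod N`. -/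
def ind {N : ℕ} (y : ZMod N) : ZMod N → ℂ := fun z => if z = y then 1 else 0

/-- The eigenstate `u_s` associated with a unit `x` of `ZMod N` of order `r`. -/
noncomputable def u {N : ℕ} (x : (ZMod N)ˣ) (s : ℕ) : ZMod N → ℂ :=
  fun z => (1 / (Real.sqrt (orderOf x) : ℂ)) *
    ∑ k ∈ Finset.range (orderOf x),
      Complex.exp (-2 * Real.pi * Complex.I * s * k / (orderOf x)) * ind ((x ^ k : (ZMod N)ˣ) : ZMod N) z

/-- The modular-multiplication operator `U_x`, with `(U_x g) z = g (x⁻¹ z)`,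
so that `U_x e_y = e_{x y}`. -/
def Ux {N : ℕ} (x : (ZMod N)ˣ) (g : ZMod N → ℂ) : ZMod N → ℂ :=
  fun z => g (((x⁻¹ : (ZMod N)ˣ) : ZMod N) * z)

theorem ind_inv_mul {N : ℕ} (x : (ZMod N)ˣ) (y z : ZMod N) :
    ind y (((x⁻¹ : (ZMod N)ˣ) : ZMod N) * z) = ind ((x : ZMod N) * y) z := by
  simp only [ind, Units.inv_mul_eq_iff_eq_mul]

theorem sum_range_succ_eq_of_eq {M : Type*} [AddCancelCommMonoid M] (f : ℕ → M) {n : ℕ}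
    (h : f n = f 0) : ∑ k ∈ range n, f (k + 1) = ∑ k ∈ range n, f k := by
  apply add_right_cancel (b := f 0)
  rw [← sum_range_succ', sum_range_succ, h]

/-- `u_s` is an eigenvector of `U_x` with eigenvalue `e^{2πis/r}`. -/
theorem u_eigenvector {N : ℕ} (hN : 2 ≤ N) (x : (ZMod N)ˣ) (s : ℕ) :
    Ux x (u x s) = fun z => Complex.exp (2 * Real.pi * Complex.I * s / (orderOf x)) * u x s z := by
  have : NeZero N := ⟨by omega⟩
  have hr : (orderOf x : ℂ) ≠ 0 := Nat.cast_ne_zero.mpr (orderOf_pos x).ne'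
  funext z
  let f : ℕ → ℂ := fun k =>
    Complex.exp (-2 * Real.pi * Complex.I * s * k / (orderOf x)) *
      ind ((x ^ k : (ZMod N)ˣ) : ZMod N) z
  have hf : f (orderOf x) = f 0 := by
    have hexp : Complex.exp (-2 * Real.pi * Complex.I * s * (orderOf x : ℕ) / (orderOf x)) = 1 := by
      rw [mul_div_cancel_right₀ _ hr, Complex.exp_eq_one_iff]
      exact ⟨-s, by push_cast; ring⟩
    simp only [f, hexp, pow_orderOf_eq_one, pow_zero, Nat.cast_zero, mul_zero, zero_div,
      Complex.exp_zero]
  simp only [Ux, u]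
  rw [mul_left_comm]
  congr 1
  change _ = _ * ∑ k ∈ range (orderOf x), f k
  rw [← sum_range_succ_eq_of_eq f hf, mul_sum]
  refine sum_congr rfl fun k _ => ?_
  simp only [f]
  rw [ind_inv_mul, ← Units.val_mul, ← pow_succ', ← mul_assoc, ← Complex.exp_add]
  congr 2
  push_cast
  field_simp
  ring
end

section
/- Grover iteration count bound: let N M : ℕ with 0 < M and 2·M ≤ N, and let θ : ℝ satisfy 0 < θ ≤ π/2 and sin(θ/2) = √(M/N). Then ⌈π/(2θ)⌉ ≤ ⌈(π/4)·√(N/M)⌉ (ceilings of real numbers, as integers). -/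
open Real

/-- Grover iteration count bound: if `sin(θ/2) = √(M/N)` with `0 < θ ≤ π/2`,
`0 < M` and `2M ≤ N`, then `⌈π/(2θ)⌉ ≤ ⌈(π/4)√(N/M)⌉`. -/
theorem grover_iteration_bound (N M : ℕ) (hM : 0 < M) (hMN : 2 * M ≤ N)
    (θ : ℝ) (hθ0 : 0 < θ) (hθ : θ ≤ Real.pi / 2)
    (hsin : Real.sin (θ / 2) = Real.sqrt ((M : ℝ) / N)) :
    ⌈Real.pi / (2 * θ)⌉ ≤ ⌈Real.pi / 4 * Real.sqrt ((N : ℝ) / M)⌉ := by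
  have hM' : (0 : ℝ) < M := by exact_mod_cast hM
  have hN' : (0 : ℝ) < N := by exact_mod_cast (by omega : 0 < N)
  have hpos : 0 < Real.sin (θ / 2) := hsin ▸ Real.sqrt_pos.2 (div_pos hM' hN')
  have hle : Real.sin (θ / 2) ≤ θ / 2 := Real.sin_le (by positivity)
  apply Int.ceil_le_ceil
  rw [← inv_div (M : ℝ) N, Real.sqrt_inv, ← hsin]
  calc Real.pi / (2 * θ) = Real.pi / 4 * (θ / 2)⁻¹ := by field_simp; norm_num
    _ ≤ Real.pi / 4 * (Real.sin (θ / 2))⁻¹ := by gcongr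
end
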